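/- For every positive integer n, the number of pairs (μ, ν) with μ ∈ E*, ν ∈ EO*, and |μ| + |ν| = n equals the number of pairs (λ, π) of partitions into parts congruent to 2 modulo 4 with |λ| + |π| = n. -/

import Mathlib

/-- A partition is a finite multiset of positive integers. -/
def IsPartition (m : Multiset ℕ) : Prop := ∀ x ∈ m, 0 < x

/-- The largest even part of a partition (0 if there are no even parts). -/
def lep (m : Multiset ℕ) : ℕ := (m.filter (fun x => Even x)).sup

/-- `EO*`: every even part is smaller than every odd part, every part other than the
largest even part appears an even number of times, and the largest even part appears
an odd number of times. -/
def EOStar (m : Multiset ℕ) : Prop :=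
  IsPartition m ∧
  (∀ x ∈ m, ∀ y ∈ m, Even x → Odd y → x < y) ∧
  (∀ x ∈ m, x ≠ lep m → Even (m.count x)) ∧
  (∀ x ∈ m, x = lep m → Odd (m.count x))

/-- `E*`: partitions into even parts where each distinct part appears an even number of times. -/
def EStar (m : Multiset ℕ) : Prop :=
  IsPartition m ∧ (∀ x ∈ m, Even x) ∧ ∀ x : ℕ, Even (m.count x)

/-- `O_k*`: partitions into odd parts with exactly `2k` parts where each distinct part
appears an even number of times. -/
def OStar (k : ℕ) (m : Multiset ℕ) : Prop :=
  IsPartition m ∧ (∀ x ∈ m, Odd x) ∧ Multiset.card m = 2 * k ∧ ∀ x : ℕ, Even (m.count x)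

/-- `Q_{k,r}`: partitions with a `(k+r+1) × k` Durfee rectangle whose largest part below
the rectangle is `< k+r+1`; equivalently, exactly `k` parts are `≥ k+r+1`. -/
def QSet (k r : ℕ) (m : Multiset ℕ) : Prop :=
  IsPartition m ∧ Multiset.card (m.filter (fun x => k + r + 1 ≤ x)) = k

/-- `EO*_{k,r}`: partitions in `EO*` with exactly `2k` odd parts and largest even part `2k+2r`. -/
def EOkr (k r : ℕ) (m : Multiset ℕ) : Prop :=
  EOStar m ∧ Multiset.card (m.filter (fun x => Odd x)) = 2 * k ∧ lep m = 2 * k + 2 * r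

/-- The even-odd crank: largest even part minus the number of odd parts. -/
def eoc (m : Multiset ℕ) : ℤ :=
  (lep m : ℤ) - (Multiset.card (m.filter (fun x => Odd x)) : ℤ)

/-- The conjugate partition: its `i`-th part is the number of parts that are `≥ i`. -/
def conjugate (m : Multiset ℕ) : Multiset ℕ :=
  (Multiset.range m.sup).map (fun i => Multiset.card (m.filter (fun x => i + 1 ≤ x)))

/-- An overpartition: a partition together with a set of overlined part values, which must
be a subset of the distinct part values. -/
def IsOverpartition (p : Multiset ℕ × Finset ℕ) : Prop :=
  IsPartition p.1 ∧ p.2 ⊆ p.1.toFinset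

section

open PowerSeries

theorem finite_partitions_sum_eq (n : ℕ) : {m : Multiset ℕ | IsPartition m ∧ m.sum = n}.Finite := by
  refine (Set.finite_range fun p : Nat.Partition n => p.parts).subset ?_
  rintro m ⟨hm, hs⟩
  exact ⟨⟨m, fun {x} hx => hm x hx, hs⟩, rfl⟩

/-- The generating function of the weight `w` on the set `A`. -/
noncomputable def weightGenFun {α : Type*} (A : Set α) (w : α → ℕ) : ℤ⟦X⟧ :=
  PowerSeries.mk fun n => ({a | a ∈ A ∧ w a = n}.ncard : ℤ)

theorem weightGenFun_prod {α β : Type*} (A : Set α) (B : Set β) (v : α → ℕ) (w : β → ℕ)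
    (hA : ∀ n, {a | a ∈ A ∧ v a = n}.Finite) (hB : ∀ n, {b | b ∈ B ∧ w b = n}.Finite) :
    weightGenFun {p : α × β | p.1 ∈ A ∧ p.2 ∈ B} (fun p => v p.1 + w p.2) =
      weightGenFun A v * weightGenFun B w := by
  classical
  ext n
  simp only [weightGenFun, coeff_mk, coeff_mul]
  have h : {p : α × β | p ∈ {p : α × β | p.1 ∈ A ∧ p.2 ∈ B} ∧ v p.1 + w p.2 = n} =
      ((Finset.HasAntidiagonal.antidiagonal n).biUnion fun ij =>
        (hA ij.1).toFinset ×ˢ (hB ij.2).toFinset : Finset (α × β)) := by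
    ext p
    simp only [Set.mem_ofPred_eq, Finset.coe_biUnion, Finset.coe_product, Set.mem_iUnion,
      Set.Finite.coe_toFinset, Set.mem_prod, SetLike.mem_coe, Finset.HasAntidiagonal.mem_antidiagonal]
    constructor
    · rintro ⟨⟨h1, h2⟩, h3⟩
      exact ⟨(v p.1, w p.2), h3, ⟨h1, rfl⟩, h2, rfl⟩
    · rintro ⟨ij, h, ⟨h1, h2⟩, h3, h4⟩
      exact ⟨⟨h1, h3⟩, by rw [h2, h4, h]⟩
  rw [h, Set.ncard_coe_finset, Finset.card_biUnion]
  · push_cast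
    refine Finset.sum_congr rfl fun ij _ => ?_
    rw [Finset.card_product, Set.ncard_eq_toFinset_card _ (hA _),
      Set.ncard_eq_toFinset_card _ (hB _)]
    push_cast
    rfl
  · rintro ⟨i, j⟩ _ ⟨i', j'⟩ _ hne
    refine Finset.disjoint_left.2 fun p hp hp' => hne ?_
    simp only [Finset.mem_product, Set.Finite.mem_toFinset, Set.mem_ofPred_eq] at hp hp'
    rw [← hp.1.2, ← hp.2.2, ← hp'.1.2, ← hp'.2.2]

theorem weightGenFun_image {α β : Type*} (A : Set α) (f : α → β) (w : β → ℕ)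
    (hf : Function.Injective f) :
    weightGenFun (f '' A) w = weightGenFun A (w ∘ f) := by
  ext n
  simp only [weightGenFun, coeff_mk]
  rw [← Set.ncard_image_of_injective {a | a ∈ A ∧ (w ∘ f) a = n} hf]
  congr 2
  ext b
  simp only [Set.mem_ofPred_eq, Set.mem_image, Function.comp_apply]
  constructor
  · rintro ⟨⟨a, ha, rfl⟩, h⟩
    exact ⟨a, ⟨ha, h⟩, rfl⟩
  · rintro ⟨a, ⟨ha, h⟩, rfl⟩
    exact ⟨⟨a, ha, rfl⟩, h⟩

theorem weightGenFun_add_const {α : Type*} (A : Set α) (w : α → ℕ) (k : ℕ) :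
    weightGenFun A (fun a => w a + k) = X ^ k * weightGenFun A w := by
  ext n
  simp only [weightGenFun, coeff_mk, coeff_X_pow_mul']
  split_ifs with h
  · congr 3
    ext a
    simp only [and_congr_right_iff]
    omega
  · have : {a | a ∈ A ∧ w a + k = n} = ∅ := by
      ext a
      simp only [Set.mem_ofPred_eq, Set.mem_empty_iff_false, iff_false, not_and]
      omega
    simp [this]

theorem weightGenFun_eq_sum_fiber {α : Type*} (A : Set α) (w f : α → ℕ) (M : ℕ)
    (hf : ∀ a ∈ A, f a < M) (hA : ∀ n, {a | a ∈ A ∧ w a = n}.Finite) :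
    weightGenFun A w = ∑ m ∈ Finset.range M, weightGenFun {a | a ∈ A ∧ f a = m} w := by
  classical
  ext n
  simp only [weightGenFun, map_sum, coeff_mk]
  rw [Set.ncard_eq_toFinset_card _ (hA n), Finset.card_eq_sum_card_fiberwise (f := f)
    (t := Finset.range M)]
  · push_cast
    refine Finset.sum_congr rfl fun m _ => ?_
    rw [← Set.ncard_coe_finset]
    congr 2
    ext a
    simp only [Finset.coe_filter, Set.Finite.mem_toFinset, Set.mem_ofPred_eq]
    tauto
  · intro a ha
    simp only [Set.Finite.coe_toFinset, Set.mem_ofPred_eq] at ha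
    simpa using hf a ha.1

theorem weightGenFun_parts_mul_prod (S : Finset ℕ) (hS : ∀ s ∈ S, 0 < s) (c : ℕ) (hc : 0 < c) :
    weightGenFun {m : Multiset ℕ | ∀ x ∈ m, x ∈ S} (fun m => c * m.sum) *
      ∏ s ∈ S, (1 - X ^ (c * s)) = 1 := by
  classical
  induction S using Finset.induction_on with
  | empty =>
    have h : {m : Multiset ℕ | ∀ x ∈ m, x ∈ (∅ : Finset ℕ)} = {0} := by
      ext m
      simp [Multiset.eq_zero_iff_forall_notMem]
    rw [h, Finset.prod_empty, mul_one]
    ext n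
    simp only [weightGenFun, coeff_mk, coeff_one, Set.mem_singleton_iff]
    split_ifs with hn
    · subst hn
      have : {a : Multiset ℕ | a = 0 ∧ c * a.sum = 0} = {0} := by
        ext a
        simp +contextual
      rw [this, Set.ncard_singleton, Nat.cast_one]
    · have : {a : Multiset ℕ | a = 0 ∧ c * a.sum = n} = ∅ := by
        ext a
        simp only [Set.mem_ofPred_eq, Set.mem_empty_iff_false, iff_false]
        rintro ⟨rfl, h⟩
        simp at h
        omega
      simp [this]
  | insert s S hs ih =>
    have hs0 : 0 < s := hS s (by simp)
    have ih := ih fun t ht => hS t (by simp [ht])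
    rw [Finset.prod_insert hs, ← mul_assoc]
    convert ih using 2
    rw [mul_sub, mul_one, sub_eq_iff_eq_add, mul_comm _ (X ^ (c * s)), ← weightGenFun_add_const]
    have hinj : Function.Injective (fun m : Multiset ℕ => s ::ₘ m) := fun a b h =>
      (Multiset.cons_inj_right s).1 h
    have himg := weightGenFun_image {m : Multiset ℕ | ∀ x ∈ m, x ∈ insert s S} (fun m => s ::ₘ m)
      (fun m => c * m.sum) hinj
    have hw : (fun m : Multiset ℕ => c * m.sum) ∘ (fun m => s ::ₘ m) =
        fun m => c * m.sum + c * s := by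
      funext m
      simp [mul_add, add_comm]
    rw [hw] at himg
    rw [← himg]
    ext n
    simp only [weightGenFun, map_add, coeff_mk]
    have hfin : ∀ T : Set (Multiset ℕ), (∀ m ∈ T, ∀ x ∈ m, x ∈ insert s S) →
        {m | m ∈ T ∧ c * m.sum = n}.Finite := by
      intro T hT
      refine (finite_partitions_sum_eq (n / c)).subset ?_
      rintro m ⟨hm, h⟩
      exact ⟨fun x hx => hS x (hT m hm x hx), by rw [← h, Nat.mul_div_cancel_left _ hc]⟩
    rw [← Nat.cast_add, ← Set.ncard_union_eq ?_ (hfin _ ?_) (hfin _ ?_)]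
    · congr 2
      ext m
      simp only [Set.mem_ofPred_eq, Set.mem_union, Set.mem_image, ← or_and_right]
      refine and_congr_left fun _ => ⟨fun h => ?_, ?_⟩
      · by_cases hsm : s ∈ m
        · exact Or.inr ⟨m.erase s, fun x hx => h x (Multiset.mem_of_mem_erase hx),
            Multiset.cons_erase hsm⟩
        · refine Or.inl fun x hx => (Finset.mem_insert.1 (h x hx)).resolve_left ?_
          rintro rfl
          exact hsm hx
      · rintro (h | ⟨m, h, rfl⟩)
        · exact fun x hx => Finset.mem_insert_of_mem (h x hx)
        · intro x hx
          rcases Multiset.mem_cons.1 hx with rfl | hx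
          · simp
          · exact h x hx
    · refine Set.disjoint_left.2 ?_
      rintro _ ⟨h, _⟩ ⟨⟨m, _, rfl⟩, _⟩
      exact hs (h s (by simp))
    · exact fun m hm x hx => Finset.mem_insert_of_mem (hm x hx)
    · rintro _ ⟨m, hm, rfl⟩ x hx
      rcases Multiset.mem_cons.1 hx with rfl | hx
      · simp
      · exact hm x hx

/-- One step of the functional equation behind the `q`-binomial theorem. -/
theorem qBinomial_step {R : Type*} [CommRing R] (y z : R) (a d : ℕ → R) (K : ℕ)
    (ha : ∀ m, a (m + 1) = a m * (1 - y ^ (2 * m + 1)))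
    (hd : ∀ m < K, d m = (1 - y ^ (2 * m + 2)) * d (m + 1)) (M : ℕ) (hM : M ≤ K) :
    (1 - z) * ∑ m ∈ Finset.range (M + 1), a m * d m * z ^ m -
      (1 - y * z) * ∑ m ∈ Finset.range (M + 1), a m * d m * (y ^ 2 * z) ^ m =
      - (a M * d M * (1 - y ^ (2 * M + 1)) * z ^ (M + 1)) := by
  induction M with
  | zero => simp; ring
  | succ M ih =>
    have ih := ih (by omega)
    rw [Finset.sum_range_succ, Finset.sum_range_succ _ (M + 1), mul_add, mul_add,
      add_sub_add_comm, ih, hd M (by omega), ha M]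
    ring

/-- The `q`-binomial theorem at the arguments needed for Andrews' identity, up to `y ^ (K + 1)`. -/
theorem pow_dvd_qBinomial_sub {R : Type*} [CommRing R] (y : R) (K : ℕ) :
    y ^ (K + 1) ∣ (∏ i ∈ Finset.range K, (1 - y ^ (2 * i + 1))) *
      (∑ m ∈ Finset.range (K + 1), (∏ i ∈ Finset.range m, (1 - y ^ (2 * i + 1))) *
        (∏ j ∈ Finset.Ico m K, (1 - y ^ (2 * j + 2))) * y ^ m) -
      (∏ j ∈ Finset.range K, (1 - y ^ (2 * j + 2))) ^ 2 := by
  set a : ℕ → R := fun m => ∏ i ∈ Finset.range m, (1 - y ^ (2 * i + 1)) with ha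
  set b : ℕ → R := fun m => ∏ i ∈ Finset.range m, (1 - y ^ (2 * i + 2)) with hb
  set d : ℕ → R := fun m => ∏ j ∈ Finset.Ico m K, (1 - y ^ (2 * j + 2)) with hd
  set S : ℕ → R := fun J => ∑ m ∈ Finset.range (K + 1), a m * d m * (y ^ (2 * J + 1)) ^ m with hS
  have hstep : ∀ J, y ^ (K + 1) ∣ (1 - y ^ (2 * J + 1)) * S J - (1 - y ^ (2 * J + 2)) * S (J + 1) := by
    intro J
    have h := qBinomial_step y (y ^ (2 * J + 1)) a d K
      (fun m => Finset.prod_range_succ _ _) (fun m hm => Finset.prod_eq_prod_Ico_succ_bot hm _)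
      K le_rfl
    have e1 : y * y ^ (2 * J + 1) = y ^ (2 * J + 2) := by ring
    have e2 : y ^ 2 * y ^ (2 * J + 1) = y ^ (2 * (J + 1) + 1) := by ring
    rw [e1, e2] at h
    simp only [hS]
    rw [h, dvd_neg, ← pow_mul]
    exact Dvd.dvd.mul_left (pow_dvd_pow _ (by nlinarith)) _
  have hall : ∀ J, y ^ (K + 1) ∣ a J * S 0 - b J * S J := by
    intro J
    induction J with
    | zero => simp [ha, hb]
    | succ J ih =>
      have e : a (J + 1) * S 0 - b (J + 1) * S (J + 1) =
          (1 - y ^ (2 * J + 1)) * (a J * S 0 - b J * S J) +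
          b J * ((1 - y ^ (2 * J + 1)) * S J - (1 - y ^ (2 * J + 2)) * S (J + 1)) := by
        rw [show a (J + 1) = _ from Finset.prod_range_succ _ _,
          show b (J + 1) = _ from Finset.prod_range_succ _ _]
        ring
      rw [e]
      exact dvd_add (ih.mul_left _) ((hstep J).mul_left _)
  have hlast : y ^ (K + 1) ∣ S K - b K := by
    have e : S K - b K = ∑ m ∈ Finset.range K, a (m + 1) * d (m + 1) * (y ^ (2 * K + 1)) ^ (m + 1) := by
      simp [hS, Finset.sum_range_succ' _ K, ha, hb, hd]
    rw [e]
    refine Finset.dvd_sum fun m _ => Dvd.dvd.mul_left ?_ _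
    rw [← pow_mul]
    exact pow_dvd_pow _ (by nlinarith)
  have hS0 : S 0 = ∑ m ∈ Finset.range (K + 1), a m * d m * y ^ m := by simp [hS]
  have e : a K * (∑ m ∈ Finset.range (K + 1), a m * d m * y ^ m) - b K ^ 2 =
      (a K * S 0 - b K * S K) + b K * (S K - b K) := by
    rw [hS0]; ring
  rw [e]
  exact dvd_add (hall K) (hlast.mul_left _)

theorem sup_mem_of_ne_zero (m : Multiset ℕ) (hm : m ≠ 0) : m.sup ∈ m := by
  induction m using Multiset.induction_on with
  | empty => exact absurd rfl hm
  | cons a s ih =>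
    rw [Multiset.sup_cons]
    by_cases hs : s = 0
    · simp [hs]
    · rcases max_cases a s.sup with ⟨h, _⟩ | ⟨h, _⟩
      · exact Multiset.mem_cons.2 (Or.inl h)
      · exact Multiset.mem_cons.2 (Or.inr (by
          change max a s.sup ∈ s
          rw [h]; exact ih hs))

theorem lep_cases (m : Multiset ℕ) : (lep m ∈ m ∧ Even (lep m)) ∨ lep m = 0 := by
  by_cases h : m.filter (fun x => Even x) = 0
  · exact Or.inr (by simp [lep, h])
  · exact Or.inl (Multiset.mem_filter.1 (sup_mem_of_ne_zero _ h))

theorem even_lep (m : Multiset ℕ) : Even (lep m) := by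
  rcases lep_cases m with h | h
  · exact h.2
  · simp [h]

theorem le_lep {m : Multiset ℕ} {x : ℕ} (hx : x ∈ m) (he : Even x) : x ≤ lep m :=
  Multiset.le_sup (Multiset.mem_filter.2 ⟨hx, he⟩)

/-- The even parts at most `2 * m` and the odd parts between `2 * m` and `2 * K`. -/
def eoParts (K m : ℕ) : Finset ℕ :=
  (Finset.range m).image (fun j => 2 * j + 2) ∪ (Finset.Ico m K).image (fun i => 2 * i + 1)

theorem mem_eoParts {K m x : ℕ} (hm : m ≤ K) : x ∈ eoParts K m ↔
    0 < x ∧ x ≤ 2 * K ∧ (Even x → x ≤ 2 * m) ∧ (Odd x → 2 * m < x) := by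
  simp only [eoParts, Finset.mem_union, Finset.mem_image, Finset.mem_range, Finset.mem_Ico]
  constructor
  · rintro (⟨j, hj, rfl⟩ | ⟨j, hj, rfl⟩)
    · refine ⟨by omega, by omega, fun _ => by omega, fun h => ?_⟩
      obtain ⟨k, hk⟩ := h
      omega
    · refine ⟨by omega, by omega, fun h => ?_, fun _ => by omega⟩
      obtain ⟨k, hk⟩ := h
      omega
  · rintro ⟨h0, h1, h2, h3⟩
    rcases Nat.even_or_odd x with h | h
    · have := h2 h
      obtain ⟨k, hk⟩ := h
      exact Or.inl ⟨k - 1, by omega, by omega⟩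
    · have := h3 h
      obtain ⟨k, hk⟩ := h
      exact Or.inr ⟨k, by omega, by omega⟩

theorem prod_eoParts {R : Type*} [CommMonoid R] (K m : ℕ) (f : ℕ → R) :
    ∏ t ∈ eoParts K m, f t =
      (∏ j ∈ Finset.range m, f (2 * j + 2)) * ∏ i ∈ Finset.Ico m K, f (2 * i + 1) := by
  rw [eoParts, Finset.prod_union, Finset.prod_image, Finset.prod_image]
  · intro a _ b _ h
    simp only at h
    omega
  · intro a _ b _ h
    simp only at h
    omega
  · refine Finset.disjoint_left.2 fun x hx hx' => ?_
    simp only [Finset.mem_image] at hx hx'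
    obtain ⟨a, _, ha⟩ := hx
    obtain ⟨b, _, hb⟩ := hx'
    omega

theorem eoStar_lep_eq_image (K m : ℕ) (hm : m ≤ K) :
    {ν | (EOStar ν ∧ ∀ x ∈ ν, x ≤ 2 * K) ∧ lep ν = 2 * m} =
      (fun ρ : Multiset ℕ => 2 • ρ + if m = 0 then 0 else {2 * m}) ''
        {ρ | ∀ x ∈ ρ, x ∈ eoParts K m} := by
  ext ν
  simp only [Set.mem_ofPred_eq, Set.mem_image]
  constructor
  · rintro ⟨⟨⟨h1, h2, h3, h4⟩, h5⟩, h6⟩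
    have hcount : ∀ x ∈ ν.erase (2 * m), 2 ∣ (ν.erase (2 * m)).count x := by
      intro x hx
      have hx := Multiset.mem_of_mem_erase hx
      rw [← even_iff_two_dvd]
      by_cases hxm : x = 2 * m
      · subst hxm
        rw [Multiset.count_erase_self]
        exact Nat.Odd.sub_odd (h4 _ hx h6.symm) odd_one
      · rw [Multiset.count_erase_of_ne hxm]
        exact h3 x hx (by rwa [h6])
    obtain ⟨ρ, hρ⟩ := Multiset.exists_smul_of_dvd_count _ hcount
    refine ⟨ρ, fun x hx => ?_, ?_⟩
    · have hx : x ∈ 2 • ρ := Multiset.mem_nsmul.2 ⟨by norm_num, hx⟩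
      rw [← hρ] at hx
      have hx : x ∈ ν := Multiset.mem_of_mem_erase hx
      refine (mem_eoParts hm).2 ⟨h1 x hx, h5 x hx, fun he => h6 ▸ le_lep hx he, fun ho => ?_⟩
      rcases lep_cases ν with h | h
      · exact h6 ▸ h2 _ h.1 _ hx h.2 ho
      · have := h1 x hx
        omega
    · rw [← hρ]
      split_ifs with h0
      · rw [add_zero, Multiset.erase_of_notMem]
        intro h
        have := h1 _ h
        omega
      · rw [add_comm, Multiset.singleton_add, Multiset.cons_erase]
        rcases lep_cases ν with h | h
        · exact h6 ▸ h.1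
        · omega
  · rintro ⟨ρ, hρ, rfl⟩
    have hmem : ∀ x ∈ (2 • ρ + if m = 0 then 0 else {2 * m} : Multiset ℕ),
        x ∈ eoParts K m := by
      intro x hx
      rcases Multiset.mem_add.1 hx with h | h
      · exact hρ x (Multiset.mem_of_mem_nsmul h)
      · split_ifs at h with h0
        · simp at h
        · rw [Multiset.mem_singleton] at h
          subst h
          refine (mem_eoParts hm).2 ⟨by omega, by omega, fun _ => le_rfl, ?_⟩
          rintro ⟨k, hk⟩
          omega
    set ν := (2 • ρ + if m = 0 then 0 else {2 * m} : Multiset ℕ) with hν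
    simp only [mem_eoParts hm] at hmem
    have hlep : lep ν = 2 * m := by
      refine le_antisymm (Multiset.sup_le.2 fun x hx => ?_) ?_
      · have hx := Multiset.mem_filter.1 hx
        exact (hmem x hx.1).2.2.1 hx.2
      · by_cases h0 : m = 0
        · simp [h0]
        · exact le_lep (by simp [hν, h0]) (even_two_mul m)
    refine ⟨⟨⟨fun x hx => (hmem x hx).1, fun x hx y hy he ho => ?_, fun x _ hxl => ?_,
      fun x hx hxl => ?_⟩, fun x hx => (hmem x hx).2.1⟩, hlep⟩
    · exact ((hmem x hx).2.2.1 he).trans_lt ((hmem y hy).2.2.2 ho)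
    · rw [hlep] at hxl
      rw [hν, Multiset.count_add, Multiset.count_nsmul]
      split_ifs
      · simp
      · simp [hxl]
    · rw [hlep] at hxl
      have h0 : m ≠ 0 := by
        have := (hmem x hx).1
        omega
      rw [hν, Multiset.count_add, Multiset.count_nsmul, if_neg h0, hxl,
        Multiset.count_singleton_self]
      exact (even_two_mul _).add_one

theorem two_nsmul_injective : Function.Injective (fun ρ : Multiset ℕ => 2 • ρ) := by
  intro a b h
  ext x
  have := congrArg (Multiset.count x) h
  simpa [Multiset.count_nsmul] using this

theorem weightGenFun_eoStar_lep_mul_prod (K m : ℕ) (hm : m ≤ K) :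
    weightGenFun {ν | (EOStar ν ∧ ∀ x ∈ ν, x ≤ 2 * K) ∧ lep ν = 2 * m} Multiset.sum *
      ((∏ j ∈ Finset.range m, (1 - (X ^ 2) ^ (2 * j + 2))) *
        ∏ i ∈ Finset.Ico m K, (1 - (X ^ 2) ^ (2 * i + 1))) = (X ^ 2) ^ m := by
  rw [eoStar_lep_eq_image K m hm, weightGenFun_image]
  · have hw : (Multiset.sum ∘ fun ρ : Multiset ℕ => 2 • ρ + if m = 0 then 0 else {2 * m}) =
        fun ρ => 2 * ρ.sum + 2 * m := by
      funext ρ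
      split_ifs with h <;> simp [h, Multiset.sum_nsmul]
    have h := weightGenFun_parts_mul_prod (eoParts K m)
      (fun s hs => ((mem_eoParts hm).1 hs).1) 2 two_pos
    simp only [pow_mul] at h
    rw [hw, weightGenFun_add_const, mul_assoc,
      ← prod_eoParts K m (fun t => (1 - (X ^ 2) ^ t : ℤ⟦X⟧)), h, mul_one, pow_mul]
  · exact (add_left_injective _).comp two_nsmul_injective

theorem weightGenFun_eStar_mul_prod (K : ℕ) :
    weightGenFun {μ | EStar μ ∧ ∀ x ∈ μ, x ≤ 2 * K} Multiset.sum *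
      ∏ j ∈ Finset.range K, (1 - (X ^ 2) ^ (2 * j + 2)) = 1 := by
  have h : {μ | EStar μ ∧ ∀ x ∈ μ, x ≤ 2 * K} =
      (fun ρ : Multiset ℕ => 2 • ρ) '' {ρ | ∀ x ∈ ρ, x ∈ eoParts K K} := by
    have hmem : ∀ x, x ∈ eoParts K K ↔ 0 < x ∧ Even x ∧ x ≤ 2 * K := by
      intro x
      rw [mem_eoParts le_rfl, ← Nat.not_even_iff_odd]
      by_cases he : Even x <;> simp [he]
    ext μ
    simp only [Set.mem_ofPred_eq, Set.mem_image, hmem]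
    constructor
    · rintro ⟨⟨h1, h2, h3⟩, h4⟩
      obtain ⟨ρ, rfl⟩ := Multiset.exists_smul_of_dvd_count μ (fun x _ => (h3 x).two_dvd)
      refine ⟨ρ, fun x hx => ?_, rfl⟩
      have hx : x ∈ 2 • ρ := Multiset.mem_nsmul.2 ⟨by norm_num, hx⟩
      exact ⟨h1 x hx, h2 x hx, h4 x hx⟩
    · rintro ⟨ρ, hρ, rfl⟩
      have hρ := fun x hx => hρ x (Multiset.mem_of_mem_nsmul (n := 2) hx)
      exact ⟨⟨fun x hx => (hρ x hx).1, fun x hx => (hρ x hx).2.1,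
        fun x => by simp [Multiset.count_nsmul]⟩, fun x hx => (hρ x hx).2.2⟩
  have hP := weightGenFun_parts_mul_prod (eoParts K K)
    (fun s hs => ((mem_eoParts le_rfl).1 hs).1) 2 two_pos
  have hw : (Multiset.sum ∘ fun ρ : Multiset ℕ => 2 • ρ) = fun ρ => 2 * ρ.sum := by
    funext ρ
    simp [Multiset.sum_nsmul]
  rw [h, weightGenFun_image _ _ _ two_nsmul_injective, hw]
  simpa [prod_eoParts, pow_mul] using hP

theorem weightGenFun_two_mod_four_mul_prod (K : ℕ) :
    weightGenFun {m : Multiset ℕ | ∀ x ∈ m, x % 4 = 2 ∧ x < 4 * K} Multiset.sum *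
      ∏ i ∈ Finset.range K, (1 - (X ^ 2) ^ (2 * i + 1)) = 1 := by
  have h := weightGenFun_parts_mul_prod ((Finset.range K).image fun i => 2 * (2 * i + 1))
    (by simp) 1 one_pos
  rw [Finset.prod_image (by intro a _ b _ h; simp only at h; omega)] at h
  simp only [one_mul, pow_mul X 2] at h
  convert h using 3
  ext m
  simp only [Set.mem_ofPred_eq, Finset.mem_image, Finset.mem_range]
  refine forall₂_congr fun x _ => ⟨fun h => ⟨x / 4, by omega, by omega⟩, ?_⟩
  rintro ⟨i, hi, rfl⟩
  omega

theorem finite_weight_sum {A : Set (Multiset ℕ)} (hA : ∀ m ∈ A, IsPartition m) (n : ℕ) :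
    {m | m ∈ A ∧ m.sum = n}.Finite :=
  (finite_partitions_sum_eq n).subset fun m hm => ⟨hA m hm.1, hm.2⟩

theorem weightGenFun_eoStar_mul_prod (K : ℕ) :
    weightGenFun {ν | EOStar ν ∧ ∀ x ∈ ν, x ≤ 2 * K} Multiset.sum *
      ((∏ i ∈ Finset.range K, (1 - (X ^ 2) ^ (2 * i + 1))) *
        ∏ j ∈ Finset.range K, (1 - (X ^ 2) ^ (2 * j + 2))) =
    ∑ m ∈ Finset.range (K + 1), (∏ i ∈ Finset.range m, (1 - (X ^ 2) ^ (2 * i + 1))) *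
        (∏ j ∈ Finset.Ico m K, (1 - (X ^ 2) ^ (2 * j + 2))) * (X ^ 2) ^ m := by
  rw [weightGenFun_eq_sum_fiber _ _ (fun ν => lep ν / 2) (K + 1) _
    (finite_weight_sum fun m hm => hm.1.1), Finset.sum_mul]
  · refine Finset.sum_congr rfl fun m hm => ?_
    have hm : m ≤ K := by simpa [Nat.lt_succ_iff] using hm
    rw [← weightGenFun_eoStar_lep_mul_prod K m hm,
      ← Finset.prod_range_mul_prod_Ico _ hm, ← Finset.prod_range_mul_prod_Ico _ hm]
    have hset : {ν | ν ∈ {ν | EOStar ν ∧ ∀ x ∈ ν, x ≤ 2 * K} ∧ lep ν / 2 = m} =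
        {ν | (EOStar ν ∧ ∀ x ∈ ν, x ≤ 2 * K) ∧ lep ν = 2 * m} := by
      ext ν
      refine and_congr_right fun _ => ?_
      obtain ⟨k, hk⟩ := even_lep ν
      omega
    rw [hset]
    ring
  · rintro ν ⟨_, h⟩
    rcases lep_cases ν with h' | h'
    · have := h _ h'.1
      omega
    · omega

theorem pow_dvd_weightGenFun_sub (K : ℕ) :
    (X ^ 2 : ℤ⟦X⟧) ^ (K + 1) ∣
      weightGenFun {μ | EStar μ ∧ ∀ x ∈ μ, x ≤ 2 * K} Multiset.sum *
        weightGenFun {ν | EOStar ν ∧ ∀ x ∈ ν, x ≤ 2 * K} Multiset.sum -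
      weightGenFun {m : Multiset ℕ | ∀ x ∈ m, x % 4 = 2 ∧ x < 4 * K} Multiset.sum *
        weightGenFun {m : Multiset ℕ | ∀ x ∈ m, x % 4 = 2 ∧ x < 4 * K} Multiset.sum := by
  have hE := weightGenFun_eStar_mul_prod K
  have hO := weightGenFun_eoStar_mul_prod K
  have hR := weightGenFun_two_mod_four_mul_prod K
  have hd := pow_dvd_qBinomial_sub (X ^ 2 : ℤ⟦X⟧) K
  rw [← hO] at hd
  generalize weightGenFun {μ | EStar μ ∧ ∀ x ∈ μ, x ≤ 2 * K} Multiset.sum = E at *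
  generalize weightGenFun {ν | EOStar ν ∧ ∀ x ∈ ν, x ≤ 2 * K} Multiset.sum = O at *
  generalize weightGenFun {m : Multiset ℕ | ∀ x ∈ m, x % 4 = 2 ∧ x < 4 * K} Multiset.sum = R at *
  generalize (∏ i ∈ Finset.range K, (1 - (X ^ 2 : ℤ⟦X⟧) ^ (2 * i + 1))) = a at *
  generalize (∏ i ∈ Finset.range K, (1 - (X ^ 2 : ℤ⟦X⟧) ^ (2 * i + 2))) = b at *
  have e : E * O - R * R = E ^ 2 * R ^ 2 * (a * (O * (a * b)) - b ^ 2) := by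
    have e1 : E ^ 2 * R ^ 2 * (a * (O * (a * b)) - b ^ 2) =
      E * O * (E * b) * (R * a) ^ 2 - R ^ 2 * (E * b) ^ 2 := by ring
    rw [e1, hE, hR]
    ring
  rw [e]
  exact hd.mul_left _


end

/-- Coefficient-wise form of Andrews' identity (1): for every positive integer `n`, the
number of pairs `(μ, ν)` with `μ ∈ E*`, `ν ∈ EO*` and `|μ| + |ν| = n` equals the number of
pairs `(λ, π)` of partitions into parts `≡ 2 (mod 4)` with `|λ| + |π| = n`. -/
theorem stmt5 (n : ℕ) (hn : 0 < n) :
    {p : Multiset ℕ × Multiset ℕ |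
      EStar p.1 ∧ EOStar p.2 ∧ p.1.sum + p.2.sum = n}.ncard =
    {p : Multiset ℕ × Multiset ℕ |
      (∀ x ∈ p.1, x % 4 = 2) ∧ (∀ x ∈ p.2, x % 4 = 2) ∧
      p.1.sum + p.2.sum = n}.ncard := by
  have hle : ∀ {m : Multiset ℕ} {k : ℕ}, m.sum ≤ k → ∀ x ∈ m, x ≤ k := fun h x hx =>
    (Multiset.single_le_sum (fun _ _ => Nat.zero_le _) x hx).trans h
  have hL : {p : Multiset ℕ × Multiset ℕ | EStar p.1 ∧ EOStar p.2 ∧ p.1.sum + p.2.sum = n} =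
      {p | p ∈ {p : Multiset ℕ × Multiset ℕ | p.1 ∈ {μ | EStar μ ∧ ∀ x ∈ μ, x ≤ 2 * n} ∧
        p.2 ∈ {ν | EOStar ν ∧ ∀ x ∈ ν, x ≤ 2 * n}} ∧ p.1.sum + p.2.sum = n} := by
    ext p
    constructor
    · rintro ⟨h1, h2, h3⟩
      exact ⟨⟨⟨h1, hle (by omega)⟩, h2, hle (by omega)⟩, h3⟩
    · rintro ⟨⟨h1, h2⟩, h3⟩
      exact ⟨h1.1, h2.1, h3⟩
  have hR : {p : Multiset ℕ × Multiset ℕ | (∀ x ∈ p.1, x % 4 = 2) ∧ (∀ x ∈ p.2, x % 4 = 2) ∧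
        p.1.sum + p.2.sum = n} =
      {p | p ∈ {p : Multiset ℕ × Multiset ℕ |
        p.1 ∈ {m : Multiset ℕ | ∀ x ∈ m, x % 4 = 2 ∧ x < 4 * n} ∧
        p.2 ∈ {m : Multiset ℕ | ∀ x ∈ m, x % 4 = 2 ∧ x < 4 * n}} ∧ p.1.sum + p.2.sum = n} := by
    ext p
    constructor
    · rintro ⟨h1, h2, h3⟩
      refine ⟨⟨fun x hx => ⟨h1 x hx, ?_⟩, fun x hx => ⟨h2 x hx, ?_⟩⟩, h3⟩
      · have := hle (k := n) (by omega) x hx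
        omega
      · have := hle (k := n) (by omega) x hx
        omega
    · rintro ⟨⟨h1, h2⟩, h3⟩
      exact ⟨fun x hx => (h1 x hx).1, fun x hx => (h2 x hx).1, h3⟩
  have hd := pow_dvd_weightGenFun_sub n
  have hpos : ∀ m ∈ {m : Multiset ℕ | ∀ x ∈ m, x % 4 = 2 ∧ x < 4 * n}, IsPartition m :=
    fun m hm x hx => by
      have := hm x hx
      omega
  rw [← weightGenFun_prod _ _ _ _ (finite_weight_sum fun m hm => hm.1.1)
      (finite_weight_sum fun m hm => hm.1.1),
    ← weightGenFun_prod _ _ _ _ (finite_weight_sum hpos) (finite_weight_sum hpos),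
    ← pow_mul, PowerSeries.X_pow_dvd_iff] at hd
  have hn := hd n (by omega)
  rw [map_sub, sub_eq_zero, weightGenFun, weightGenFun, PowerSeries.coeff_mk, PowerSeries.coeff_mk] at hn
  rw [hL, hR]
  exact_mod_cast hn
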